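/- Let W be a 3-dimensional vector space over a field of characteristic zero. For a rank-2 symmetric 3×3 matrix C with adjugate C' = Ĉ (which has rank 1), the image of the map Λ²W∨ ⊕ Λ²W → W ⊗ W∨ given by (ξ', ξ) ↦ C·ξ' + ξ·C' has dimension 3 and is contained in sl(W) (all elements are traceless). Here Λ²W∨ and Λ²W are identified with spaces of skew-symmetric 3×3 matrices, and C·ξ', ξ·C' denote matrix products. -/

import Mathlib

open Matrix

theorem aux_trace {k : Type*} [Field k] [CharZero k]
    (C X : Matrix (Fin 3) (Fin 3) k) (hC : Cᵀ = C) (hX : Xᵀ = -X) :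
    Matrix.trace (C * X) = 0 := by
  have h : Matrix.trace (C * X) = - Matrix.trace (C * X) := by
    conv_lhs => rw [← Matrix.trace_transpose, Matrix.transpose_mul, hC, hX, Matrix.neg_mul,
      Matrix.trace_neg, Matrix.trace_mul_comm]
  exact self_eq_neg.mp h

/-- The skew matrix attached to a vector. -/
def skewOf {k : Type*} [Field k] : (Fin 3 → k) →ₗ[k] Matrix (Fin 3) (Fin 3) k where
  toFun p := !![0, p 0, p 1; -p 0, 0, p 2; -p 1, -p 2, 0]
  map_add' p q := by
    ext i j; fin_cases i <;> fin_cases j <;> simp <;> ring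
  map_smul' c q := by
    ext i j; fin_cases i <;> fin_cases j <;> simp

theorem skewOf_skew {k : Type*} [Field k] (p : Fin 3 → k) : (skewOf p)ᵀ = - skewOf p := by
  ext i j; fin_cases i <;> fin_cases j <;> simp [skewOf]

theorem skewOf_surj {k : Type*} [Field k] [CharZero k] (X : Matrix (Fin 3) (Fin 3) k)
    (hX : Xᵀ = -X) : ∃ p, skewOf p = X := by
  have h : ∀ i j, X j i = - X i j := fun i j => congrFun (congrFun hX i) j
  have hd : ∀ i, X i i = 0 := fun i => self_eq_neg.mp (h i i)
  refine ⟨![X 0 1, X 0 2, X 1 2], ?_⟩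
  ext i j; fin_cases i <;> fin_cases j <;> simp [skewOf, hd, h 0 1, h 0 2, h 1 2]

theorem image_of_rank2_symmetric_map
    {k : Type*} [Field k] [CharZero k]
    (C : Matrix (Fin 3) (Fin 3) k) (hsymm : Cᵀ = C) (hrank : C.rank = 2) :
    (∀ ξ' ξ : Matrix (Fin 3) (Fin 3) k, ξ'ᵀ = -ξ' → ξᵀ = -ξ →
      Matrix.trace (C * ξ' + ξ * adjugate C) = 0) ∧
    Module.finrank k
      (Submodule.span k
        {M : Matrix (Fin 3) (Fin 3) k |
          ∃ ξ' ξ : Matrix (Fin 3) (Fin 3) k,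
            ξ'ᵀ = -ξ' ∧ ξᵀ = -ξ ∧ M = C * ξ' + ξ * adjugate C}) = 3 := by
  have hA : (adjugate C)ᵀ = adjugate C := by rw [Matrix.adjugate_transpose, hsymm]
  refine ⟨fun X Y hX hY => ?_, ?_⟩
  · rw [Matrix.trace_add, aux_trace C X hsymm hX, Matrix.trace_mul_comm,
      aux_trace _ Y hA hY, add_zero]
  have hr : Module.finrank k (LinearMap.range C.mulVecLin) = 2 := hrank
  have hn := LinearMap.finrank_range_add_finrank_ker C.mulVecLin
  have hk : Module.finrank k (LinearMap.ker C.mulVecLin) = 1 := by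
    simp at hn; omega
  obtain ⟨⟨v, hv⟩, hv0, hspan⟩ := finrank_eq_one_iff'.mp hk
  have hv0 : v ≠ 0 := fun h => hv0 (by simp [h])
  have hv : C *ᵥ v = 0 := by simpa using hv
  have hspan : ∀ w, C *ᵥ w = 0 → ∃ c : k, c • v = w := fun w hw => by
    obtain ⟨c, hc⟩ := hspan ⟨w, by simpa using hw⟩
    exact ⟨c, congrArg Subtype.val hc⟩
  obtain ⟨i0, hi0⟩ := Function.ne_iff.mp hv0
  have hi0 : v i0 ≠ 0 := hi0
  -- matrices killed by C
  have hmat : ∀ X : Matrix (Fin 3) (Fin 3) k, C * X = 0 → ∃ b : Fin 3 → k,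
      ∀ i j, X i j = b j * v i := fun X hX => by
    have : ∀ j, ∃ c : k, c • v = fun i => X i j := fun j => hspan _ (by
      ext i
      exact congrFun (congrFun hX i) j)
    choose b hb using this
    exact ⟨b, fun i j => (congrFun (hb j) i).symm⟩
  have hdet : C.det = 0 := Matrix.exists_mulVec_eq_zero_iff.mp ⟨v, hv0, hv⟩
  -- range of C
  have hrange : ∀ y, v ⬝ᵥ y = 0 → ∃ w, C *ᵥ w = y := by
    let φ : (Fin 3 → k) →ₗ[k] k := dotProductBilin k k v
    have hφ : ∀ y, φ y = v ⬝ᵥ y := fun y => rfl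
    have hle : LinearMap.range C.mulVecLin ≤ LinearMap.ker φ := by
      rintro _ ⟨w, rfl⟩
      rw [LinearMap.mem_ker, hφ, Matrix.mulVecLin_apply, Matrix.dotProduct_mulVec,
        ← Matrix.mulVec_transpose, hsymm, hv, zero_dotProduct]
    have hφ0 : φ ≠ 0 := fun h => hi0 (by
      have := hφ (Pi.single i0 1)
      rw [h] at this
      simpa using this.symm)
    have h1 : Module.finrank k (LinearMap.range φ) = 1 := by
      rw [LinearMap.range_eq_top.mpr (LinearMap.surjective hφ0)]; simp
    have h2 := LinearMap.finrank_range_add_finrank_ker φ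
    have h3 : Module.finrank k (LinearMap.ker φ) = 2 := by
      simp only [Module.finrank_fin_fun] at h2; omega
    have heq := Submodule.eq_of_le_of_finrank_eq hle (hr.trans h3.symm)
    intro y hy
    have : y ∈ LinearMap.range C.mulVecLin := by rw [heq]; exact hy
    exact this
  let f : (Fin 3 → k) →ₗ[k] Matrix (Fin 3) (Fin 3) k := (LinearMap.mulLeft k C) ∘ₗ skewOf
  have hf : ∀ p, f p = C * skewOf p := fun p => rfl
  have hinj : Function.Injective f := by
    rw [injective_iff_map_eq_zero]
    intro p hp
    obtain ⟨b, hb⟩ := hmat _ hp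
    have hs : ∀ i j, skewOf p j i = - skewOf p i j :=
      fun i j => congrFun (congrFun (skewOf_skew p) i) j
    have hb0 : ∀ j, b j = 0 := fun j => by
      have h1 := self_eq_neg.mp (hs i0 i0)
      rw [hb] at h1
      have h1 : b i0 = 0 := (mul_eq_zero.mp h1).resolve_right hi0
      have h2 := hs j i0
      rw [hb, hb, h1] at h2
      simpa [hi0] using h2
    have h0 : ∀ i j, skewOf p i j = 0 := fun i j => by rw [hb, hb0, zero_mul]
    ext i
    fin_cases i
    · exact h0 0 1
    · exact h0 0 2
    · exact h0 1 2
  have hset : {M : Matrix (Fin 3) (Fin 3) k |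
          ∃ ξ' ξ : Matrix (Fin 3) (Fin 3) k,
            ξ'ᵀ = -ξ' ∧ ξᵀ = -ξ ∧ M = C * ξ' + ξ * adjugate C} = LinearMap.range f := by
    ext M
    constructor
    · rintro ⟨X, Y, hX, hY, rfl⟩
      obtain ⟨b, hb⟩ := hmat (adjugate C) (by rw [Matrix.mul_adjugate, hdet, zero_smul])
      have hc : ∃ c : k, adjugate C = c • vecMulVec v v := by
        refine ⟨b i0 / v i0, ?_⟩
        ext i j
        have h1 : adjugate C i0 j = adjugate C j i0 := congrFun (congrFun hA j) i0
        rw [hb, hb] at h1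
        rw [hb]
        simp only [Matrix.smul_apply, vecMulVec_apply, smul_eq_mul]
        field_simp
        linear_combination v i * h1
      obtain ⟨c, hc⟩ := hc
      have hvY : v ⬝ᵥ (Y *ᵥ v) = 0 := by
        apply self_eq_neg.mp
        conv_lhs => rw [Matrix.dotProduct_mulVec, ← Matrix.mulVec_transpose, hY,
          Matrix.neg_mulVec, neg_dotProduct, dotProduct_comm]
      obtain ⟨w, hw⟩ := hrange _ hvY
      obtain ⟨p, hp⟩ := skewOf_surj X hX
      obtain ⟨q, hq⟩ := skewOf_surj (c • (vecMulVec w v - vecMulVec v w)) (by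
        rw [transpose_smul, transpose_sub, transpose_vecMulVec, transpose_vecMulVec,
          ← smul_neg, neg_sub])
      refine ⟨p + q, ?_⟩
      rw [map_add, hf, hf, hp, hq, hc, Matrix.mul_smul, Matrix.mul_smul, Matrix.mul_sub,
        Matrix.mul_vecMulVec, Matrix.mul_vecMulVec, Matrix.mul_vecMulVec, hw, hv]
      simp
    · rintro ⟨p, rfl⟩
      exact ⟨skewOf p, 0, skewOf_skew p, by simp, by simp [hf]⟩
  rw [hset, Submodule.span_eq, LinearMap.finrank_range_of_inj hinj]
  simp
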